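/- Let X be a Banach space and S : ℓ¹ → X a bounded linear operator such that the range of the adjoint S* : X* → ℓ∞ is dense in ℓ∞. Then S*(X*) = ℓ∞. -/

import Mathlib

open Filter Topology

lemma l1_summable (x : lp (fun _ : ℕ => ℂ) 1) : Summable (fun k => ‖x k‖) := by
  have := (lp.memℓp x).summable (by norm_num)
  simpa using this

lemma l1_norm (x : lp (fun _ : ℕ => ℂ) 1) : ‖x‖ = ∑' k, ‖x k‖ := by
  have := lp.norm_eq_tsum_rpow (p := 1) (by norm_num) x
  simpa using this

/-- The functional given by a bounded sequence. -/
lemma l1_functional (a : ℕ → ℂ) (ha : ∀ k, ‖a k‖ ≤ 1) :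
    ∃ φ : lp (fun _ : ℕ => ℂ) 1 →L[ℂ] ℂ, ∀ x, φ x = ∑' k, a k * x k := by
  have hb : ∀ (x : lp (fun _ : ℕ => ℂ) 1) k, ‖a k * x k‖ ≤ ‖x k‖ := fun x k => by
    rw [norm_mul]
    exact mul_le_of_le_one_left (norm_nonneg _) (ha k)
  have hs : ∀ x : lp (fun _ : ℕ => ℂ) 1, Summable (fun k => a k * x k) := fun x =>
    Summable.of_norm_bounded (l1_summable x) (hb x)
  refine ⟨LinearMap.mkContinuous
    { toFun := fun x => ∑' k, a k * x k
      map_add' := fun x y => ?_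
      map_smul' := fun c x => ?_ } 1 (fun x => ?_), fun x => rfl⟩
  · rw [← (hs x).tsum_add (hs y)]
    congr 1; ext k
    simp [mul_add]
  · simp only [RingHom.id_apply, smul_eq_mul]
    rw [← tsum_mul_left]
    congr 1; ext k
    simp; ring
  · rw [one_mul, l1_norm]
    exact tsum_of_norm_bounded (l1_summable x).hasSum (hb x)

lemma l1_coord (k : ℕ) : ∃ φ : lp (fun _ : ℕ => ℂ) 1 →L[ℂ] ℂ, ∀ x, φ x = x k := by
  obtain ⟨φ, hφ⟩ := l1_functional (fun j => if j = k then 1 else 0)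
    (fun j => by split_ifs <;> simp)
  refine ⟨φ, fun x => ?_⟩
  rw [hφ, tsum_eq_single k]
  · simp
  · intro j hj; simp [hj]

lemma l1_schur (x : ℕ → lp (fun _ : ℕ => ℂ) 1) (hx : ∀ n, ‖x n‖ = 1)
    (hw : ∀ φ : lp (fun _ : ℕ => ℂ) 1 →L[ℂ] ℂ, Tendsto (fun n => φ (x n)) atTop (𝓝 0)) :
    False := by
  have step : ∀ N : ℕ, ∃ n M : ℕ, N ≤ n ∧ N < M ∧
      3 / 4 < ∑ k ∈ Finset.Ico N M, ‖x n k‖ := by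
    intro N
    have h1 : Tendsto (fun n => ∑ k ∈ Finset.range N, ‖x n k‖) atTop (𝓝 0) := by
      have : Tendsto (fun n => ∑ k ∈ Finset.range N, ‖x n k‖) atTop
          (𝓝 (∑ k ∈ Finset.range N, 0)) := by
        refine tendsto_finsetSum _ (fun k _ => ?_)
        obtain ⟨φ, hφ⟩ := l1_coord k
        have := (hw φ).norm
        simpa [hφ] using this
      simpa using this
    obtain ⟨n, hn1, hn2⟩ := ((h1.eventually (gt_mem_nhds (show (0 : ℝ) < 1 / 8 by norm_num))).and
      (eventually_ge_atTop N)).exists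
    have h2 := (l1_summable (x n)).hasSum.tendsto_sum_nat
    rw [← l1_norm, hx] at h2
    obtain ⟨M, hM1, hM2⟩ := ((h2.eventually (lt_mem_nhds (show (7 / 8 : ℝ) < 1 by norm_num))).and
      (eventually_gt_atTop N)).exists
    refine ⟨n, M, hn2, hM2, ?_⟩
    rw [Finset.sum_Ico_eq_sub _ hM2.le]
    linarith
  choose n M hn hM hsum using step
  let P : ℕ → ℕ := fun j => M^[j] 0
  have hP : ∀ j, P (j + 1) = M (P j) := fun j => Function.iterate_succ_apply' M j 0
  have hPm : StrictMono P := strictMono_nat_of_lt_succ (fun j => by rw [hP]; exact hM _)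
  have huniq : ∀ i j k, k ∈ Finset.Ico (P i) (P (i + 1)) → k ∈ Finset.Ico (P j) (P (j + 1)) →
      i = j := by
    intro i j k hi hj
    rw [Finset.mem_Ico] at hi hj
    have h1 : i < j + 1 := hPm.lt_iff_lt.1 (hi.1.trans_lt hj.2)
    have h2 : j < i + 1 := hPm.lt_iff_lt.1 (hj.1.trans_lt hi.2)
    omega
  have hex : ∀ k, ∃ a : ℂ, ‖a‖ ≤ 1 ∧ ∀ j, k ∈ Finset.Ico (P j) (P (j + 1)) →
      a * x (n (P j)) k = (‖x (n (P j)) k‖ : ℂ) := by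
    intro k
    by_cases hk : ∃ j, k ∈ Finset.Ico (P j) (P (j + 1))
    · obtain ⟨j, hj⟩ := hk
      obtain ⟨a, ha, hab⟩ : ∃ a : ℂ, ‖a‖ ≤ 1 ∧
          a * x (n (P j)) k = (‖x (n (P j)) k‖ : ℂ) := by
        generalize x (n (P j)) k = z
        by_cases hz : z = 0
        · exact ⟨0, by simp, by simp [hz]⟩
        · refine ⟨(‖z‖ : ℂ) / z, ?_, div_mul_cancel₀ _ hz⟩
          simp [hz]
      refine ⟨a, ha, fun i hi => ?_⟩
      rw [huniq i j k hi hj]; exact hab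
    · exact ⟨0, by simp, fun j hj => (hk ⟨j, hj⟩).elim⟩
  choose a ha hab using hex
  obtain ⟨φ, hφ⟩ := l1_functional a ha
  have key : ∀ j, 1 / 2 ≤ ‖φ (x (n (P j)))‖ := by
    intro j
    set y := x (n (P j)) with hy
    have hb : ∀ k, ‖a k * y k‖ ≤ ‖y k‖ := fun k => by
      rw [norm_mul]
      exact mul_le_of_le_one_left (norm_nonneg _) (ha k)
    have hys := l1_summable y
    have hs : Summable (fun k => a k * y k) := Summable.of_norm_bounded hys hb
    let B := Finset.Ico (P j) (P (j + 1))
    have e1 := hys.sum_add_tsum_compl (s := B)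
    have e2 := hs.sum_add_tsum_compl (s := B)
    rw [← l1_norm, hy, hx, ← hy] at e1
    rw [← hφ] at e2
    have e3 : ∑ k ∈ B, a k * y k = ((∑ k ∈ B, ‖y k‖ : ℝ) : ℂ) := by
      push_cast
      exact Finset.sum_congr rfl (fun k hk => hab k j hk)
    have e4 : 3 / 4 < ∑ k ∈ B, ‖y k‖ := by
      have := hsum (P j)
      rwa [← hP] at this
    have e5 := tsum_of_norm_bounded
      (hys.subtype ((B : Set ℕ)ᶜ)).hasSum (f := fun k : ((B : Set ℕ)ᶜ : Set ℕ) => a k * y k)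
      (fun k => hb k)
    replace e5 : ‖∑' k : ((B : Set ℕ)ᶜ : Set ℕ), a k * y k‖ ≤
        ∑' k : ((B : Set ℕ)ᶜ : Set ℕ), ‖y k‖ := e5
    have e6 : ‖∑ k ∈ B, a k * y k‖ = ∑ k ∈ B, ‖y k‖ := by
      rw [e3, Complex.norm_real, Real.norm_of_nonneg (by linarith)]
    have e7 := norm_sub_le_norm_add (∑ k ∈ B, a k * y k)
      (∑' k : ((B : Set ℕ)ᶜ : Set ℕ), a k * y k)
    rw [e2, e6] at e7
    linarith
  have hnt : Tendsto (fun j => n (P j)) atTop atTop :=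
    tendsto_atTop_mono (fun j => (hPm.id_le j).trans (hn _)) tendsto_id
  have h0 := ((hw φ).comp hnt).norm
  rw [norm_zero] at h0
  have := ge_of_tendsto' h0 key
  norm_num at this

/-- Beurling's theorem: if `S : ℓ¹ → X` has adjoint with dense range in `(ℓ¹)* = ℓ∞`,
then the adjoint is surjective. -/
theorem beurling_adjoint_dense_range_eq
    {X : Type*} [NormedAddCommGroup X] [NormedSpace ℂ X] [CompleteSpace X]
    (S : lp (fun _ : ℕ => ℂ) 1 →L[ℂ] X)
    (h : Dense (Set.range (fun g : X →L[ℂ] ℂ => g.comp S))) :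
    Set.range (fun g : X →L[ℂ] ℂ => g.comp S) = Set.univ := by
  have hbelow : ∃ c : ℝ, 0 < c ∧ ∀ x, c * ‖x‖ ≤ ‖S x‖ := by
    by_contra! hc
    have hex : ∀ m : ℕ, ∃ x : lp (fun _ : ℕ => ℂ) 1, ‖x‖ = 1 ∧ ‖S x‖ ≤ 1 / ((m : ℝ) + 1) := by
      intro m
      obtain ⟨x, hx⟩ := hc (1 / ((m : ℝ) + 1)) (by positivity)
      have hx0 : x ≠ 0 := by
        rintro rfl
        simp at hx
      have hpos : 0 < ‖x‖ := norm_pos_iff.2 hx0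
      refine ⟨((‖x‖⁻¹ : ℝ) : ℂ) • x, ?_, ?_⟩
      · rw [norm_smul, Complex.norm_real, norm_inv, norm_norm, inv_mul_cancel₀ hpos.ne']
      · rw [map_smul, norm_smul, Complex.norm_real, norm_inv, norm_norm, inv_mul_le_iff₀ hpos]
        linarith
    choose x hx hSx using hex
    refine l1_schur x hx (fun φ => ?_)
    have hS0 : Tendsto (fun n => S (x n)) atTop (𝓝 0) :=
      squeeze_zero_norm hSx tendsto_one_div_add_atTop_nhds_zero_nat
    rw [Metric.tendsto_atTop]
    intro ε hε
    obtain ⟨_, ⟨g, rfl⟩, hg⟩ := h.exists_dist_lt φ (half_pos hε)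
    have hg0 : Tendsto (fun n => g (S (x n))) atTop (𝓝 0) := by
      simpa [Function.comp_def] using (g.continuous.tendsto 0).comp hS0
    obtain ⟨N, hN⟩ := Metric.tendsto_atTop.1 hg0 (ε / 2) (half_pos hε)
    refine ⟨N, fun n hn => ?_⟩
    have h1 := hN n hn
    have h2 := (φ - g.comp S).le_opNorm (x n)
    rw [hx, mul_one, ← dist_eq_norm] at h2
    have h3 : φ (x n) = (φ - g.comp S) (x n) + g (S (x n)) := by simp
    rw [dist_zero_right] at h1 ⊢
    rw [h3]
    have h4 := norm_add_le ((φ - g.comp S) (x n)) (g (S (x n)))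
    have h5 : dist φ (g.comp S) < ε / 2 := hg
    linarith
  obtain ⟨c, hc, hcS⟩ := hbelow
  have hinj : Function.Injective (S : lp (fun _ : ℕ => ℂ) 1 →ₗ[ℂ] X) := by
    rw [injective_iff_map_eq_zero]
    intro x hx
    have := hcS x
    have hx' : S x = 0 := hx
    rw [hx', norm_zero] at this
    have : ‖x‖ ≤ 0 := by
      by_contra! hh
      have := mul_pos hc hh
      linarith
    simpa using this
  rw [Set.eq_univ_iff_forall]
  intro φ
  let e := LinearEquiv.ofInjective (S : lp (fun _ : ℕ => ℂ) 1 →ₗ[ℂ] X) hinj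
  have he : ∀ x, ((e x : _) : X) = S x := fun x => rfl
  let f := LinearMap.mkContinuous
    ((φ : lp (fun _ : ℕ => ℂ) 1 →ₗ[ℂ] ℂ).comp e.symm.toLinearMap) (‖φ‖ * c⁻¹) (by
      intro y
      obtain ⟨x, rfl⟩ := e.surjective y
      have h1 := φ.le_opNorm x
      have h2 : ‖x‖ ≤ c⁻¹ * ‖e x‖ := by
        rw [le_inv_mul_iff₀ hc]
        exact hcS x
      have h3 := mul_le_mul_of_nonneg_left h2 (norm_nonneg φ)
      simp only [LinearMap.comp_apply, LinearEquiv.coe_coe, LinearEquiv.symm_apply_apply]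
      rw [mul_assoc]
      exact h1.trans h3)
  obtain ⟨g, hg, -⟩ := exists_extension_norm_eq _ f
  refine ⟨g, ?_⟩
  ext1 x
  have h1 := hg (e x)
  rw [he] at h1
  change g (S x) = φ x
  rw [h1]
  change φ (e.symm (e x)) = φ x
  rw [LinearEquiv.symm_apply_apply]
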